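/- arXiv:2309.01663 — 7 statements merged into one kernel-verified Lean document; each statement's English description precedes it below -/
import Mathlib

section
/- With the balanced-tree gene-tree class probabilities h1, h2, h3, h4, h5 defined below for an integer n ≥ 1, if 1/n ≤ x ≤ 1 and 1/n ≤ y ≤ 1, then h1 ≥ h2. -/
/-- `D(n)` from the paper: `(C(n,2) − 2(n−1) + 1)/C(n,2)` for `n ≥ 4`, and `0` otherwise. -/
noncomputable def Dbal (n : ℕ) : ℝ :=
  if 4 ≤ n then ((n : ℝ) * ((n : ℝ) - 1) / 2 - 2 * ((n : ℝ) - 1) + 1) /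
    ((n : ℝ) * ((n : ℝ) - 1) / 2) else 0

/-- Probability of the species-tree (balanced) gene-tree topology class. -/
noncomputable def h1 (n : ℕ) (x y : ℝ) : ℝ :=
  x * y + (x * (1 - y) + (1 - x) * y) * (((n : ℝ) - 2) / (3 * (n : ℝ))) *
    (if 3 ≤ n then 1 else 0) + (1 - x) * (1 - y) * Dbal n / 9

/-- Probability of either alternative balanced gene-tree topology. -/
noncomputable def h2 (n : ℕ) (x y : ℝ) : ℝ :=
  (1 - x) * (1 - y) * ((2 * (n : ℝ) - 1) / (3 * (n : ℝ) * ((n : ℝ) - 1)) *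
    (if 2 ≤ n then 1 else 0) + Dbal n / 9)

/-- Probability of a caterpillar gene-tree topology with cherry `{a,b}`. -/
noncomputable def h3 (n : ℕ) (x y : ℝ) : ℝ :=
  x * (1 - y) * ((1 / (n : ℝ)) * (if 2 ≤ n then 1 else 0) +
    (((n : ℝ) - 2) / (3 * (n : ℝ))) * (if 3 ≤ n then 1 else 0)) +
    (1 - x) * (1 - y) * Dbal n / 18

/-- Probability of a caterpillar gene-tree topology with cherry `{c,d}`. -/
noncomputable def h4 (n : ℕ) (x y : ℝ) : ℝ :=
  (1 - x) * y * ((1 / (n : ℝ)) * (if 2 ≤ n then 1 else 0) +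
    (((n : ℝ) - 2) / (3 * (n : ℝ))) * (if 3 ≤ n then 1 else 0)) +
    (1 - x) * (1 - y) * Dbal n / 18

/-- Probability of any of the remaining caterpillar gene-tree topologies. -/
noncomputable def h5 (n : ℕ) (x y : ℝ) : ℝ :=
  (1 - x) * (1 - y) * ((((n : ℝ) - 2) / (3 * (n : ℝ) * ((n : ℝ) - 1))) *
    (if 3 ≤ n then 1 else 0) + Dbal n / 18)

theorem h1_ge_h2 (n : ℕ) (hn : 1 ≤ n) (x y : ℝ)
    (hx1 : 1 / (n : ℝ) ≤ x) (hx2 : x ≤ 1)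
    (hy1 : 1 / (n : ℝ) ≤ y) (hy2 : y ≤ 1) :
    h1 n x y ≥ h2 n x y := by
  have hx0 : 0 ≤ x := le_trans (by positivity) hx1
  have hy0 : 0 ≤ y := le_trans (by positivity) hy1
  rcases Nat.lt_or_ge n 2 with h | h
  · have h1n : n = 1 := by omega
    subst h1n
    norm_num at hx1 hy1
    have hx : x = 1 := le_antisymm hx2 hx1
    have hy : y = 1 := le_antisymm hy2 hy1
    subst hx hy
    norm_num [h1, h2]
  have hN : (2 : ℝ) ≤ n := by exact_mod_cast h
  have hc : ((n : ℝ) - 2) / (3 * (n : ℝ)) * (if 3 ≤ n then 1 else 0)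
      = ((n : ℝ) - 2) / (3 * (n : ℝ)) := by
    split_ifs with h3
    · ring
    · have : n = 2 := by omega
      subst this
      norm_num
  unfold h1 h2
  rw [mul_assoc (x * (1 - y) + (1 - x) * y), hc, if_pos h]
  generalize Dbal n = d
  generalize (n : ℝ) = N at *
  have hN0 : 0 < N := by linarith
  have hm : 0 < N - 1 := by linarith
  rw [div_le_iff₀ hN0] at hx1 hy1
  have hu : 1 - x ≤ (N - 1) * x := by linarith
  have hv : 1 - y ≤ (N - 1) * y := by linarith
  have u0 : 0 ≤ 1 - x := by linarith
  have v0 : 0 ≤ 1 - y := by linarith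
  have a := mul_le_mul_of_nonneg_right hu v0
  have b := mul_le_mul_of_nonneg_left hv u0
  have c := mul_le_mul hu hv v0 (by positivity)
  have a' := mul_le_mul_of_nonneg_left a (by linarith : 0 ≤ N - 2)
  have b' := mul_le_mul_of_nonneg_left b (by linarith : 0 ≤ N - 2)
  have e : 0 ≤ (N - 1) * (x * y) := by positivity
  have key : 0 ≤ 3 * N * (N - 1) * (x * y)
      + (x * (1 - y) + (1 - x) * y) * ((N - 1) * (N - 2))
      - (1 - x) * (1 - y) * (2 * N - 1) := by
    linarith
  have id : x * y + (x * (1 - y) + (1 - x) * y) * ((N - 2) / (3 * N))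
      + (1 - x) * (1 - y) * d / 9
      - (1 - x) * (1 - y) * ((2 * N - 1) / (3 * N * (N - 1)) * 1 + d / 9)
      = (3 * N * (N - 1) * (x * y)
      + (x * (1 - y) + (1 - x) * y) * ((N - 1) * (N - 2))
      - (1 - x) * (1 - y) * (2 * N - 1)) / (3 * N * (N - 1)) := by
    have := hm.ne'
    field_simp
    ring
  have := div_nonneg key (by positivity : 0 ≤ 3 * N * (N - 1))
  rw [← id] at this
  linarith
end

section
/- With the balanced-tree gene-tree class probabilities h1, h2, h3, h4, h5 defined below for an integer n ≥ 1, if 0 ≤ x ≤ 1 and 0 ≤ y ≤ 1, then h2 ≥ h5. -/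
theorem Dbal_nonneg_aux (n : ℕ) : 0 ≤ Dbal n := by
  unfold Dbal
  split_ifs with h
  · have h4 : (4 : ℝ) ≤ n := by exact_mod_cast h
    apply div_nonneg
    · nlinarith [mul_nonneg (by linarith : (0 : ℝ) ≤ n - 1) (by linarith : (0 : ℝ) ≤ n - 4)]
    · nlinarith
  · exact le_rfl

theorem h2_ge_h5 (n : ℕ) (hn : 1 ≤ n) (x y : ℝ)
    (hx1 : 0 ≤ x) (hx2 : x ≤ 1) (hy1 : 0 ≤ y) (hy2 : y ≤ 1) :
    h2 n x y ≥ h5 n x y := by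
  have hD := Dbal_nonneg_aux n
  have hp : 0 ≤ (1 - x) * (1 - y) := mul_nonneg (by linarith) (by linarith)
  unfold h2 h5
  apply mul_le_mul_of_nonneg_left _ hp
  by_cases h2' : 2 ≤ n
  · have hn2 : (2 : ℝ) ≤ n := by exact_mod_cast h2'
    have hd : 0 < 3 * (n : ℝ) * ((n : ℝ) - 1) := by
      apply mul_pos <;> linarith
    have hb : ((n : ℝ) - 2) / (3 * (n : ℝ) * ((n : ℝ) - 1)) ≤
        (2 * (n : ℝ) - 1) / (3 * (n : ℝ) * ((n : ℝ) - 1)) :=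
      div_le_div_of_nonneg_right (by linarith) hd.le
    have ha : 0 ≤ (2 * (n : ℝ) - 1) / (3 * (n : ℝ) * ((n : ℝ) - 1)) :=
      div_nonneg (by linarith) hd.le
    rw [if_pos h2']
    split_ifs <;> linarith
  · have h3' : ¬ 3 ≤ n := by omega
    rw [if_neg h2', if_neg h3']
    linarith
end

section
/- With the balanced-tree gene-tree class probabilities h1, h2, h3, h4, h5 defined below for an integer n ≥ 1, if 0 ≤ x ≤ 1 and 1/n ≤ y ≤ 1, then h1 ≥ h3. -/
theorem h1_ge_h3 (n : ℕ) (hn : 1 ≤ n) (x y : ℝ)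
    (hx1 : 0 ≤ x) (hx2 : x ≤ 1)
    (hy1 : 1 / (n : ℝ) ≤ y) (hy2 : y ≤ 1) :
    h1 n x y ≥ h3 n x y := by
  have hD := Dbal_nonneg_aux n
  have hc : 0 ≤ (((n : ℝ) - 2) / (3 * (n : ℝ))) * (if 3 ≤ n then (1 : ℝ) else 0) := by
    split_ifs with h
    · have h3 : (3 : ℝ) ≤ n := by exact_mod_cast h
      have : 0 ≤ ((n : ℝ) - 2) / (3 * (n : ℝ)) := div_nonneg (by linarith) (by linarith)
      linarith
    · simp
  have hn0 : 0 ≤ 1 / (n : ℝ) := by positivity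
  have hy0 : 0 ≤ y := le_trans hn0 hy1
  have he : (1 / (n : ℝ)) * (if 2 ≤ n then (1 : ℝ) else 0) ≤ y := by
    split_ifs <;> linarith
  have he0 : 0 ≤ (1 / (n : ℝ)) * (if 2 ≤ n then (1 : ℝ) else 0) := by
    split_ifs <;> linarith
  unfold h1 h3
  rw [mul_assoc (x * (1 - y) + (1 - x) * y)]
  generalize (((n : ℝ) - 2) / (3 * (n : ℝ))) * (if 3 ≤ n then (1 : ℝ) else 0) = c at *
  generalize (1 / (n : ℝ)) * (if 2 ≤ n then (1 : ℝ) else 0) = e at *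
  generalize Dbal n = D at *
  have a1 : 0 ≤ x * (y - e) := mul_nonneg hx1 (by linarith)
  have a2 : 0 ≤ x * y * e := by positivity
  have a3 : 0 ≤ (1 - x) * y * c := mul_nonneg (mul_nonneg (by linarith) hy0) hc
  have a4 : 0 ≤ (1 - x) * (1 - y) * D :=
    mul_nonneg (mul_nonneg (by linarith) (by linarith)) hD
  linarith
end

section
/- With the balanced-tree gene-tree class probabilities h1, h2, h3, h4, h5 defined below for an integer n ≥ 1, if 1/n ≤ x ≤ 1 and 0 ≤ y ≤ 1, then h3 ≥ h5. -/
theorem h3_ge_h5 (n : ℕ) (hn : 1 ≤ n) (x y : ℝ)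
    (hx1 : 1 / (n : ℝ) ≤ x) (hx2 : x ≤ 1)
    (hy1 : 0 ≤ y) (hy2 : y ≤ 1) :
    h3 n x y ≥ h5 n x y := by
  have hn0 : (0 : ℝ) < n := by exact_mod_cast hn
  have hx0 : 0 ≤ x := le_trans (by positivity) hx1
  have hxn : 1 ≤ x * n := by rwa [div_le_iff₀ hn0] at hx1
  have hy : 0 ≤ 1 - y := by linarith
  unfold h3 h5
  by_cases h : 3 ≤ n
  · have hn3 : (3 : ℝ) ≤ n := by exact_mod_cast h
    have hn1 : (0 : ℝ) < (n : ℝ) - 1 := by linarith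
    have h2 : 2 ≤ n := by omega
    rw [if_pos h, if_pos h2]
    have key : (1 - x) * (((n : ℝ) - 2) / (3 * (n : ℝ) * ((n : ℝ) - 1))) ≤
        x * (1 / (n : ℝ) + ((n : ℝ) - 2) / (3 * (n : ℝ))) := by
      have e : x * (1 / (n : ℝ) + ((n : ℝ) - 2) / (3 * (n : ℝ))) =
          (x * ((n : ℝ) + 1) * ((n : ℝ) - 1)) / (3 * (n : ℝ) * ((n : ℝ) - 1)) := by
        field_simp
        ring
      rw [e, ← mul_div_assoc]
      apply div_le_div_of_nonneg_right _ (by positivity)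
      have a : (1 - x) * ((n : ℝ) - 2) ≤ (x * ((n : ℝ) - 1)) * ((n : ℝ) - 2) :=
        mul_le_mul_of_nonneg_right (by linarith) (by linarith)
      have b : 0 ≤ x * ((n : ℝ) - 1) := by positivity
      linarith
    have := mul_le_mul_of_nonneg_right key hy
    linarith
  · rw [if_neg h]
    have : 0 ≤ x * (1 - y) * ((1 / (n : ℝ)) * (if 2 ≤ n then 1 else 0)) := by
      split_ifs <;> positivity
    linarith
end

section
/- With the balanced-tree gene-tree class probabilities h1, h2, h3, h4, h5 defined below for an integer n ≥ 1, if 1/n ≤ x ≤ 1 and 1/n ≤ y ≤ 1, then h1 ≥ h4 and h4 ≥ h5. -/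
theorem h1_ge_h4_and_h4_ge_h5 (n : ℕ) (hn : 1 ≤ n) (x y : ℝ)
    (hx1 : 1 / (n : ℝ) ≤ x) (hx2 : x ≤ 1)
    (hy1 : 1 / (n : ℝ) ≤ y) (hy2 : y ≤ 1) :
    h1 n x y ≥ h4 n x y ∧ h4 n x y ≥ h5 n x y := by
  have hn0 : (1 : ℝ) ≤ n := by exact_mod_cast hn
  have hnpos : (0 : ℝ) < n := by linarith
  have hinv : 0 < 1 / (n : ℝ) := by positivity
  have hx0 : 0 < x := by linarith
  have hy0 : 0 < y := by linarith
  have hx' : 0 ≤ 1 - x := by linarith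
  have hy' : 0 ≤ 1 - y := by linarith
  have hD : 0 ≤ Dbal n := by
    unfold Dbal
    split_ifs with h
    · have h4 : (4 : ℝ) ≤ n := by exact_mod_cast h
      apply div_nonneg <;> nlinarith
    · exact le_rfl
  have hxyD : 0 ≤ (1 - x) * (1 - y) * Dbal n := by positivity
  have hxy : y * (1 / (n : ℝ)) ≤ y * x := mul_le_mul_of_nonneg_left hx1 hy0.le
  have hxyn : 0 ≤ x * (y * (1 / (n : ℝ))) := by positivity
  have hxyn2 : 0 ≤ (1 - x) * (y * (1 / (n : ℝ))) := by positivity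
  have hp : 0 ≤ x * y := by positivity
  by_cases h3 : 3 ≤ n
  · have h2 : 2 ≤ n := by omega
    have h3r : (3 : ℝ) ≤ n := by exact_mod_cast h3
    have hn1 : (0 : ℝ) < (n : ℝ) - 1 := by linarith
    have hn2 : (0 : ℝ) ≤ (n : ℝ) - 2 := by linarith
    have hc : 0 ≤ ((n : ℝ) - 2) / (3 * (n : ℝ)) := by positivity
    have hcx : 0 ≤ x * (1 - y) * (((n : ℝ) - 2) / (3 * (n : ℝ))) := by positivity
    have hny : 1 ≤ y * n := (div_le_iff₀ hnpos).1 hy1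
    have hq : (1 - y) / ((n : ℝ) - 1) ≤ y := by
      rw [div_le_iff₀ hn1]; linarith
    have hk : (((n : ℝ) - 2) / (3 * (n : ℝ) * ((n : ℝ) - 1))) * (1 - y) =
        ((n : ℝ) - 2) / (3 * (n : ℝ)) * ((1 - y) / ((n : ℝ) - 1)) := by
      field_simp
    have hm := mul_le_mul_of_nonneg_left (mul_le_mul_of_nonneg_left hq hc) hx'
    rw [← hk] at hm
    simp only [h1, h4, h5, h2, h3, if_true, mul_one]
    constructor <;> linarith
  · by_cases h2 : 2 ≤ n
    · simp only [h1, h4, h5, h2, h3, if_true, if_false, mul_one, mul_zero, add_zero, zero_add]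
      constructor <;> linarith
    · simp only [h1, h4, h5, h2, h3, if_false, mul_zero, add_zero, zero_add]
      constructor <;> linarith
end

section
/- With the caterpillar-tree gene-tree topology probabilities k1, ..., k8 defined below for an integer n ≥ 1, under the stated hypotheses one has k1 ≥ k5. -/
/-- `S = 1 − y − 2v − 3z`. -/
noncomputable def Scat (y v z : ℝ) : ℝ := 1 - y - 2 * v - 3 * z

/-- `B = (1/n)·1(n≥2) + (1 − 2/n)·(1/3)·1(n≥3)`. -/
noncomputable def Bcat (n : ℕ) : ℝ :=
  (1 / (n : ℝ)) * (if 2 ≤ n then 1 else 0) +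
    (1 - 2 / (n : ℝ)) * (1 / 3) * (if 3 ≤ n then 1 else 0)

/-- `C9 = (1/(3n))·1(n≥3) + (1 − 3/n)·(1/9)·1(n≥4)`. -/
noncomputable def C9cat (n : ℕ) : ℝ :=
  (1 / (3 * (n : ℝ))) * (if 3 ≤ n then 1 else 0) +
    (1 - 3 / (n : ℝ)) * (1 / 9) * (if 4 ≤ n then 1 else 0)

/-- `C18 = (1/(3n))·1(n≥3) + (1 − 3/n)·(1/18)·1(n≥4)`. -/
noncomputable def C18cat (n : ℕ) : ℝ :=
  (1 / (3 * (n : ℝ))) * (if 3 ≤ n then 1 else 0) +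
    (1 - 3 / (n : ℝ)) * (1 / 18) * (if 4 ≤ n then 1 else 0)

/-- `E = (1 − 3/n)·(1/18)·1(n≥4)`. -/
noncomputable def Ecat (n : ℕ) : ℝ :=
  (1 - 3 / (n : ℝ)) * (1 / 18) * (if 4 ≤ n then 1 else 0)

/-- Probability of the species caterpillar topology `(((a,b),c),d)`. -/
noncomputable def k1 (n : ℕ) (w x y v z : ℝ) : ℝ :=
  w * x + w * (1 - x) * (1 - 2 / (n : ℝ)) * (1 / 3) * (if 3 ≤ n then 1 else 0) +
    (1 - w) * y / 3 +
    (1 - w) * z * (1 - 2 / (n : ℝ)) * (1 / 3) * (if 3 ≤ n then 1 else 0) +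
    (1 - w) * Scat y v z * Ecat n

/-- Probability of the balanced topology `((a,b),(c,d))`. -/
noncomputable def k2 (n : ℕ) (w x y v z : ℝ) : ℝ :=
  w * (1 - x) * Bcat n + (1 - w) * z * Bcat n + (1 - w) * Scat y v z * C9cat n

/-- Probability of either alternate balanced topology, e.g. `((a,c),(b,d))`. -/
noncomputable def k3 (n : ℕ) (w x y v z : ℝ) : ℝ :=
  (1 - w) * z * Bcat n + (1 - w) * Scat y v z * C9cat n

/-- Probability of the caterpillar topology `(((a,b),d),c)`. -/
noncomputable def k4 (n : ℕ) (w x y v z : ℝ) : ℝ :=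
  w * (1 - x) * Bcat n + (1 - w) * z * Bcat n + (1 - w) * Scat y v z * Ecat n

/-- Probability of the caterpillar topology `(((c,d),a),b)`. -/
noncomputable def k5 (n : ℕ) (w x y v z : ℝ) : ℝ :=
  (1 - w) * Scat y v z * C18cat n

/-- Probability of the caterpillar topology `(((a,c),b),d)`. -/
noncomputable def k6 (n : ℕ) (w x y v z : ℝ) : ℝ :=
  (1 - w) * v + (1 - w) * y / 3 +
    (1 - w) * z * (1 - 2 / (n : ℝ)) * (1 / 3) * (if 3 ≤ n then 1 else 0) +
    (1 - w) * Scat y v z * Ecat n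

/-- Probability of the caterpillar topology `(((a,c),d),b)`. -/
noncomputable def k7 (n : ℕ) (w x y v z : ℝ) : ℝ :=
  (1 - w) * z * Bcat n + (1 - w) * Scat y v z * C18cat n

/-- Probability of the caterpillar topologies `(((b,d),a),c)` and `(((b,d),c),a)`. -/
noncomputable def k8 (n : ℕ) (w x y v z : ℝ) : ℝ :=
  (1 - w) * Scat y v z * C18cat n

theorem k1_ge_k5 (n : ℕ) (hn : 1 ≤ n) (w x y v z : ℝ)
    (hw1 : 1 / (n : ℝ) ≤ w) (hw2 : w ≤ 1)
    (hx1 : 1 / (n : ℝ) ≤ x) (hx2 : x ≤ 1)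
    (hy : 0 ≤ y) (hv : 0 ≤ v) (hz : 0 ≤ z)
    (hsum : y + 2 * v + 3 * z ≤ 1)  :
    k1 n w x y v z ≥ k5 n w x y v z := by
  have hn0 : (0 : ℝ) < n := by exact_mod_cast hn
  have ht0 : 0 < 1 / (n : ℝ) := by positivity
  have h2 : 2 / (n : ℝ) = 2 * (1 / (n : ℝ)) := by ring
  have h3 : 1 / (3 * (n : ℝ)) = (1 / (n : ℝ)) / 3 := by
    field_simp
  have hS0 : 0 ≤ Scat y v z := by unfold Scat; linarith
  have hS1 : Scat y v z ≤ 1 := by unfold Scat; linarith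
  have hw0 : 0 ≤ 1 - w := by linarith
  have hwy : 0 ≤ (1 - w) * y := mul_nonneg hw0 hy
  have hwz : 0 ≤ (1 - w) * z := mul_nonneg hw0 hz
  have hwp : 0 < w := lt_of_lt_of_le ht0 hw1
  have hxp : 0 < x := lt_of_lt_of_le ht0 hx1
  have hwx : 0 ≤ w * x := by positivity
  have hC : C18cat n = (1 / (n : ℝ)) / 3 * (if 3 ≤ n then 1 else 0) + Ecat n := by
    unfold C18cat Ecat
    rw [h3]
  unfold k1 k5
  rw [hC, h2]
  by_cases h : 3 ≤ n
  · have hnR : (3 : ℝ) ≤ n := by exact_mod_cast h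
    have ht3 : 1 / (n : ℝ) ≤ 1 / 3 := one_div_le_one_div_of_le (by norm_num) hnR
    simp only [if_pos h, mul_one]
    generalize 1 / (n : ℝ) = t at *
    generalize Ecat n = e at *
    generalize Scat y v z = S at *
    have a1 : 0 ≤ (1 - w) * z * (1 - 2 * t) := mul_nonneg hwz (by linarith)
    have a2 : (1 - w) * S ≤ 1 := by nlinarith
    have a3 : (1 - w) * S * t ≤ t := by nlinarith
    have a4 : 0 ≤ w * ((x - t) * (2 + 2 * t)) :=
      mul_nonneg hwp.le (mul_nonneg (by linarith) (by linarith))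
    have a5 : 0 ≤ w * t ^ 2 := by positivity
    nlinarith
  · simp only [if_neg h, mul_zero]
    linarith
end

section
/- With the caterpillar-tree gene-tree topology probabilities k1, ..., k8 defined below for an integer n ≥ 1, under the stated hypotheses one has k1 ≥ k7 and k1 ≥ k8. -/
theorem k1_ge_k7_k8 (n : ℕ) (hn : 1 ≤ n) (w x y v z : ℝ)
    (hw1 : 1 / (n : ℝ) ≤ w) (hw2 : w ≤ 1)
    (hx1 : 1 / (n : ℝ) ≤ x) (hx2 : x ≤ 1)
    (hy : 0 ≤ y) (hv : 0 ≤ v) (hz : 0 ≤ z)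
    (hsum : y + 2 * v + 3 * z ≤ 1)  :
    k1 n w x y v z ≥ k7 n w x y v z ∧ k1 n w x y v z ≥ k8 n w x y v z := by
  have hn0 : (0:ℝ) < n := by exact_mod_cast hn
  have hw' : 0 ≤ 1 - w := by linarith
  have hx' : 0 ≤ 1 - x := by linarith
  have hk : k7 n w x y v z ≥ k8 n w x y v z := by
    have hB : 0 ≤ Bcat n := by
      unfold Bcat
      by_cases h3 : 3 ≤ n
      · have h2 : 2 ≤ n := by omega
        have h3' : (3:ℝ) ≤ n := by exact_mod_cast h3
        have : 2 / (n:ℝ) ≤ 1 := by rw [div_le_one hn0]; linarith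
        have : 0 < 1 / (n:ℝ) := by positivity
        simp only [h2, h3, if_true]
        linarith
      · simp only [h3, if_false, mul_zero, add_zero]
        split_ifs <;> positivity
    have := mul_nonneg (mul_nonneg hw' hz) hB
    unfold k7 k8
    linarith
  suffices h : k1 n w x y v z ≥ k7 n w x y v z from ⟨h, le_trans hk h⟩
  have hwy := mul_nonneg hw' hy
  have hwv := mul_nonneg hw' hv
  by_cases h3 : 3 ≤ n
  · have h2 : 2 ≤ n := by omega
    have h3' : (3:ℝ) ≤ n := by exact_mod_cast h3
    have e2 : 2 / (n:ℝ) = 2 * (1 / (n:ℝ)) := by ring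
    have e3 : 1 / (3 * (n:ℝ)) = (1 / 3) * (1 / (n:ℝ)) := by field_simp
    have ht : 1 / (n:ℝ) ≤ 1 / 3 := one_div_le_one_div_of_le (by norm_num) h3'
    have ht0 : 0 < 1 / (n:ℝ) := by positivity
    unfold k1 k7 Bcat C18cat Ecat Scat
    simp only [h2, h3, if_true, e2, e3]
    generalize 1 / (n:ℝ) = t at *
    have hw0 : 0 ≤ w := by linarith
    have a1 : 0 ≤ w * ((x - t) * (2 + 2 * t)) :=
      mul_nonneg hw0 (mul_nonneg (by linarith) (by linarith))
    have a2 : 0 ≤ w * (t * t) := by positivity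
    have a3 : 0 ≤ w * t := by positivity
    have a4 : 0 ≤ (1 - w) * y * t := by positivity
    have a5 : 0 ≤ (1 - w) * v * t := by positivity
    linarith
  · have h4 : ¬ 4 ≤ n := by omega
    unfold k1 k7 Bcat C18cat Ecat Scat
    simp only [h3, h4, if_false]
    have : n = 1 ∨ n = 2 := by omega
    rcases this with rfl | rfl
    · norm_num at *
      have : w = 1 := le_antisymm hw2 hw1
      have : x = 1 := le_antisymm hx2 hx1
      subst w x
      norm_num
    · norm_num at *
      have hz3 : z ≤ 1 / 3 := by linarith
      nlinarith [mul_nonneg (sub_nonneg.2 hw2) (sub_nonneg.2 hz3), mul_nonneg (sub_nonneg.2 hw1) (sub_nonneg.2 hx1)]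
end
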